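/- arXiv:2106.09452 — 2 statements merged into one kernel-verified Lean document; each statement's English description precedes it below -/
import Mathlib

section
/- Fix n ∈ ℕ, α > 0 and a multi-index K ∈ ℕ₀^n, and let {a_N}_{N > n} be positive reals with a_N/√(N−1) → α as N → ∞. Define ω_{a_N,α}(x) := (1 − |x|₂²/a_N²)^{(N−n−1)/2} (2πα²)^{n/2} e^{|x|₂²/(2α²)} for |x|₂ < a_N and ω_{a_N,α}(x) := 0 otherwise. Then the functions (2πα²)^{−n/4} · Q_{N,n,K;a_N} · √(ω_{a_N,α}) converge to Q_{n,K;α} strongly in L²(γ^n_α) as N → ∞. -/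
open MvPolynomial Filter Finset

/-- Laplacian of a multivariate polynomial, taken with respect to the variables in `s`. -/
noncomputable def lapOn {σ : Type*} [DecidableEq σ] (s : Finset σ)
    (p : MvPolynomial σ ℝ) : MvPolynomial σ ℝ :=
  ∑ i ∈ s, pderiv i (pderiv i p)

/-- `c_j(m) = -1/(2j(m+2j-1))`. -/
noncomputable def cSmall (m j : ℕ) : ℝ := -1 / ((2 * j) * ((m : ℝ) + 2 * j - 1))

/-- `C_j(m) = ∏_{l=1}^j c_l(m)`, with `C_0(m) = 1`. -/
noncomputable def cBig (m j : ℕ) : ℝ := ∏ l ∈ Finset.Icc 1 j, cSmall m l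

/-- The polynomial
`Q_{N,n,K;a}(x) = Σ_{j=0}^{⌊|K|/2⌋} C_j(N−n) (a²−|x|₂²)^j Δ^j_{ℝ^n} x^K` on `ℝ^n`. -/
noncomputable def Qpoly (n N : ℕ) (a : ℝ) (K : Fin n → ℕ) : MvPolynomial (Fin n) ℝ :=
  ∑ j ∈ Finset.range ((∑ i, K i) / 2 + 1),
    C (cBig (N - n) j) *
      ((C (a ^ 2) - ∑ i : Fin n, X i ^ 2) ^ j *
        (lapOn (Finset.univ : Finset (Fin n)))^[j] (∏ i : Fin n, X i ^ K i))

/-- The polynomial `Q_{n,K;α}(x) = Σ_{j=0}^{⌊|K|/2⌋} (−1)^j (α^{2j}/(2^j j!)) Δ^j_{ℝ^n} x^K`. -/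
noncomputable def Qlim (n : ℕ) (α : ℝ) (K : Fin n → ℕ) : MvPolynomial (Fin n) ℝ :=
  ∑ j ∈ Finset.range ((∑ i, K i) / 2 + 1),
    C ((-1 : ℝ) ^ j * α ^ (2 * j) / (2 ^ j * (Nat.factorial j))) *
      (lapOn (Finset.univ : Finset (Fin n)))^[j] (∏ i : Fin n, X i ^ K i)

open MeasureTheory

/-- The Gaussian measure `γ^n_α` on `ℝ^n` with variance `α²`. -/
noncomputable def gaussMeasure (n : ℕ) (α : ℝ) : Measure (Fin n → ℝ) :=
  volume.withDensity fun x =>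
    ENNReal.ofReal ((2 * Real.pi * α ^ 2) ^ (-(n : ℝ) / 2) *
      Real.exp (-(∑ i, x i ^ 2) / (2 * α ^ 2)))

/-- The weight `ω_{a,α}(x) = (1−|x|²/a²)^{(N−n−1)/2} (2πα²)^{n/2} e^{|x|²/(2α²)}` for `|x| < a`,
and `0` otherwise. -/
noncomputable def omegaWeight (n N : ℕ) (a α : ℝ) (x : Fin n → ℝ) : ℝ :=
  if (∑ i, x i ^ 2) < a ^ 2 then
    (1 - (∑ i, x i ^ 2) / a ^ 2) ^ (((N : ℝ) - n - 1) / 2) *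
      (2 * Real.pi * α ^ 2) ^ ((n : ℝ) / 2) * Real.exp ((∑ i, x i ^ 2) / (2 * α ^ 2))
  else 0


lemma aux_a2 (α : ℝ) (a : ℕ → ℝ)
    (hlim : Tendsto (fun N : ℕ => a N / Real.sqrt ((N : ℝ) - 1)) atTop (nhds α)) :
    Tendsto (fun N : ℕ => a N ^ 2 / ((N : ℝ) - 1)) atTop (nhds (α ^ 2)) := by
  refine (hlim.pow 2).congr' ?_
  filter_upwards [eventually_ge_atTop 1] with N hN
  have : (1 : ℝ) ≤ N := by exact_mod_cast hN
  rw [div_pow, Real.sq_sqrt (by linarith)]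

lemma aux_shift (s t : ℝ) :
    Tendsto (fun N : ℕ => ((N : ℝ) + s) / ((N : ℝ) + t)) atTop (nhds 1) := by
  have h1 : Tendsto (fun N : ℕ => (N : ℝ) + t) atTop atTop :=
    tendsto_atTop_add_const_right _ _ tendsto_natCast_atTop_atTop
  have h2 : Tendsto (fun N : ℕ => 1 + (s - t) / ((N : ℝ) + t)) atTop (nhds (1 + 0)) :=
    tendsto_const_nhds.add (tendsto_const_nhds.div_atTop h1)
  rw [add_zero] at h2
  refine h2.congr' ?_
  filter_upwards [h1.eventually_gt_atTop 0] with N hN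
  field_simp
  ring

lemma aux_a2s (α : ℝ) (a : ℕ → ℝ)
    (hlim : Tendsto (fun N : ℕ => a N / Real.sqrt ((N : ℝ) - 1)) atTop (nhds α)) (t : ℝ) :
    Tendsto (fun N : ℕ => a N ^ 2 / ((N : ℝ) + t)) atTop (nhds (α ^ 2)) := by
  have h := (aux_a2 α a hlim).mul (aux_shift (-1) t)
  rw [mul_one] at h
  refine h.congr' ?_
  filter_upwards [eventually_gt_atTop 1] with N hN
  have : (1 : ℝ) < N := by exact_mod_cast hN
  have h3 : (N : ℝ) - 1 ≠ 0 := by linarith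
  rw [← sub_eq_add_neg, div_mul_div_cancel₀ h3]

lemma aux_csmall (n : ℕ) (α : ℝ) (a : ℕ → ℝ)
    (hlim : Tendsto (fun N : ℕ => a N / Real.sqrt ((N : ℝ) - 1)) atTop (nhds α)) (l : ℕ) :
    Tendsto (fun N : ℕ => cSmall (N - n) l * a N ^ 2) atTop (nhds (-α ^ 2 / (2 * l))) := by
  have h := (aux_a2s α a hlim (2 * l - 1 - n)).const_mul (-1 / (2 * (l : ℝ)))
  have e : -1 / (2 * (l : ℝ)) * α ^ 2 = -α ^ 2 / (2 * l) := by ring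
  rw [e] at h
  refine h.congr' ?_
  filter_upwards [eventually_ge_atTop n] with N hN
  unfold cSmall
  rw [Nat.cast_sub hN, div_mul_div_comm, div_mul_eq_mul_div]
  congr 2
  ring

lemma aux_cbig (n : ℕ) (α : ℝ) (a : ℕ → ℝ)
    (hlim : Tendsto (fun N : ℕ => a N / Real.sqrt ((N : ℝ) - 1)) atTop (nhds α)) (j : ℕ) :
    Tendsto (fun N : ℕ => cBig (N - n) j * (a N ^ 2) ^ j) atTop
      (nhds ((-1 : ℝ) ^ j * α ^ (2 * j) / (2 ^ j * (Nat.factorial j)))) := by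
  induction j with
  | zero => simp [cBig]
  | succ j ih =>
    have h := ih.mul (aux_csmall n α a hlim (j + 1))
    have e : ((-1 : ℝ) ^ j * α ^ (2 * j) / (2 ^ j * (Nat.factorial j))) *
        (-α ^ 2 / (2 * ((j + 1 : ℕ) : ℝ))) =
        (-1 : ℝ) ^ (j + 1) * α ^ (2 * (j + 1)) / (2 ^ (j + 1) * (Nat.factorial (j + 1))) := by
      rw [Nat.factorial_succ, div_mul_div_comm]
      push_cast
      congr 1 <;> ring
    rw [e] at h
    refine h.congr fun N => ?_
    unfold cBig
    rw [Finset.prod_Icc_succ_top (by omega)]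
    ring

lemma aux_atop (α : ℝ) (hα : 0 < α) (a : ℕ → ℝ)
    (hlim : Tendsto (fun N : ℕ => a N / Real.sqrt ((N : ℝ) - 1)) atTop (nhds α)) :
    Tendsto (fun N : ℕ => a N ^ 2) atTop atTop := by
  have h := (aux_a2s α a hlim 0).pos_mul_atTop (by positivity)
    (tendsto_natCast_atTop_atTop (R := ℝ))
  refine h.congr' ?_
  filter_upwards [eventually_gt_atTop 0] with N hN
  have : (0 : ℝ) < N := by exact_mod_cast hN
  rw [add_zero]
  field_simp

lemma aux_p (n : ℕ) (α : ℝ) (hα : 0 < α) (a : ℕ → ℝ)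
    (hlim : Tendsto (fun N : ℕ => a N / Real.sqrt ((N : ℝ) - 1)) atTop (nhds α)) :
    Tendsto (fun N : ℕ => (((N : ℝ) - n - 1) / 2) / a N ^ 2) atTop (nhds (1 / (2 * α ^ 2))) := by
  have h := ((aux_a2s α a hlim (- n - 1)).inv₀ (by positivity)).div_const 2
  have e : (α ^ 2)⁻¹ / 2 = 1 / (2 * α ^ 2) := by field_simp
  rw [e] at h
  refine h.congr fun N => ?_
  rw [inv_div]
  ring

lemma aux_int1 (b : ℝ) (hb : 0 < b) (k : ℕ) :
    Integrable (fun x : ℝ => x ^ k * Real.exp (-b * x ^ 2)) := by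
  have := integrable_rpow_mul_exp_neg_mul_sq hb (s := (k : ℝ))
    (lt_of_lt_of_le (by norm_num) (Nat.cast_nonneg k))
  simpa using this

lemma aux_int (n : ℕ) (b : ℝ) (hb : 0 < b) (p : MvPolynomial (Fin n) ℝ) :
    Integrable (fun x : Fin n → ℝ => MvPolynomial.eval x p * Real.exp (-b * ∑ i, x i ^ 2)) := by
  induction p using MvPolynomial.induction_on' with
  | monomial u c =>
    have h : Integrable (fun x : Fin n → ℝ => ∏ i, (x i ^ (u i) * Real.exp (-b * x i ^ 2))) :=
      Integrable.fintype_prod (f := fun (i : Fin n) (x : ℝ) => x ^ (u i) * Real.exp (-b * x ^ 2))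
        (fun i => aux_int1 b hb (u i))
    refine (h.const_mul c).congr (Eventually.of_forall fun x => ?_)
    simp only [MvPolynomial.eval_monomial]
    rw [Finset.prod_mul_distrib, Finset.mul_sum, Real.exp_sum, Finsupp.prod_fintype _ _ (by simp)]
    ring
  | add p q hp hq =>
    refine (hp.add hq).congr (Eventually.of_forall fun x => ?_)
    simp [add_mul]

lemma aux_weight_lim (n : ℕ) (α : ℝ) (hα : 0 < α) (a : ℕ → ℝ)
    (hlim : Tendsto (fun N : ℕ => a N / Real.sqrt ((N : ℝ) - 1)) atTop (nhds α)) (r : ℝ) :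
    Tendsto (fun N : ℕ => (1 - r / a N ^ 2) ^ (((N : ℝ) - n - 1) / 2)) atTop
      (nhds (Real.exp (-(r / (2 * α ^ 2))))) := by
  have hu : Tendsto (fun N : ℕ => 1 - r / a N ^ 2) atTop (nhds 1) := by
    have := (tendsto_const_nhds (x := r)).div_atTop (aux_atop α hα a hlim)
    simpa using this.const_sub 1
  have hp : Tendsto (fun N : ℕ => -((((N : ℝ) - n - 1) / 2) * (r / a N ^ 2))) atTop
      (nhds (-(r / (2 * α ^ 2)))) := by
    have := ((aux_p n α hα a hlim).mul_const r).neg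
    have e : -(1 / (2 * α ^ 2) * r) = -(r / (2 * α ^ 2)) := by ring
    rw [e] at this
    refine this.congr fun N => ?_
    ring
  have hq : Tendsto (fun N : ℕ => -((((N : ℝ) - n - 1) / 2) * (r / a N ^ 2)) * (1 - r / a N ^ 2)⁻¹)
      atTop (nhds (-(r / (2 * α ^ 2)))) := by
    have := hp.mul (hu.inv₀ one_ne_zero)
    simpa using this
  have hpos : ∀ᶠ N : ℕ in atTop, 0 < 1 - r / a N ^ 2 := hu.eventually_const_lt one_pos
  have hlog : Tendsto (fun N : ℕ => Real.log (1 - r / a N ^ 2) * (((N : ℝ) - n - 1) / 2)) atTop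
      (nhds (-(r / (2 * α ^ 2)))) := by
    refine tendsto_of_tendsto_of_tendsto_of_le_of_le' hq hp ?_ ?_
    · filter_upwards [hpos, eventually_ge_atTop (n + 1)] with N h hN
      have hN' : ((n : ℝ) + 1) ≤ N := by exact_mod_cast hN
      have h1 := Real.one_sub_inv_le_log_of_pos h
      have h2 := mul_le_mul_of_nonneg_right h1 (show 0 ≤ ((N : ℝ) - n - 1) / 2 by linarith)
      refine le_trans (le_of_eq ?_) h2
      have h3 : 1 - (1 - r / a N ^ 2)⁻¹ = - (r / a N ^ 2) * (1 - r / a N ^ 2)⁻¹ := by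
        have := mul_inv_cancel₀ h.ne'
        linear_combination -this
      rw [h3]
      ring
    · filter_upwards [hpos, eventually_ge_atTop (n + 1)] with N h hN
      have hN' : ((n : ℝ) + 1) ≤ N := by exact_mod_cast hN
      have h1 := Real.log_le_sub_one_of_pos h
      have h2 := mul_le_mul_of_nonneg_right h1 (show 0 ≤ ((N : ℝ) - n - 1) / 2 by linarith)
      refine le_trans h2 (le_of_eq ?_)
      ring
  refine ((Real.continuous_exp.tendsto _).comp hlog).congr' ?_
  filter_upwards [hpos] with N h
  rw [Real.rpow_def_of_pos h]
  rfl

lemma aux_weight_le (A p b r : ℝ) (hA : 0 < A) (hp : 0 ≤ p) (hb : b ≤ p / A) (hr : 0 ≤ r)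
    (hrA : r < A) : (1 - r / A) ^ p ≤ Real.exp (-b * r) := by
  have h : 0 < 1 - r / A := by
    rw [sub_pos, div_lt_one hA]
    exact hrA
  rw [Real.rpow_def_of_pos h, Real.exp_le_exp]
  have h1 := mul_le_mul_of_nonneg_right (Real.log_le_sub_one_of_pos h) hp
  have h2 := mul_le_mul_of_nonneg_right hb hr
  have h3 : (1 - r / A - 1) * p = -(p / A * r) := by ring
  linarith

lemma aux_const (n : ℕ) (t : ℝ) (ht : 0 < t) :
    (t ^ (-(n : ℝ) / 4)) ^ 2 * t ^ ((n : ℝ) / 2) = 1 := by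
  rw [← Real.rpow_natCast, ← Real.rpow_mul ht.le, ← Real.rpow_add ht]
  rw [← Real.rpow_zero t]
  congr 1
  push_cast
  ring

lemma aux_omega_nonneg (n N : ℕ) (a α : ℝ) (x : Fin n → ℝ) :
    0 ≤ omegaWeight n N a α x := by
  unfold omegaWeight
  split_ifs with h
  · have h0 : 0 ≤ ∑ i, x i ^ 2 := Finset.sum_nonneg fun i _ => sq_nonneg _
    have : 0 ≤ 1 - (∑ i, x i ^ 2) / a ^ 2 := by
      rw [sub_nonneg, div_le_one (by linarith)]
      exact h.le
    positivity
  · exact le_rfl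

/-- The prefactor squared: `(2πα²)^{-n/2} ω → 1`. -/
lemma aux_pref_lim (n : ℕ) (α : ℝ) (hα : 0 < α) (a : ℕ → ℝ)
    (hlim : Tendsto (fun N : ℕ => a N / Real.sqrt ((N : ℝ) - 1)) atTop (nhds α))
    (x : Fin n → ℝ) :
    Tendsto (fun N : ℕ => (2 * Real.pi * α ^ 2) ^ (-(n : ℝ) / 4) *
      Real.sqrt (omegaWeight n N (a N) α x)) atTop (nhds 1) := by
  have ht : 0 < 2 * Real.pi * α ^ 2 := by positivity
  have h1 : Tendsto (fun N : ℕ => omegaWeight n N (a N) α x) atTop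
      (nhds ((2 * Real.pi * α ^ 2) ^ ((n : ℝ) / 2))) := by
    have h := ((aux_weight_lim n α hα a hlim (∑ i, x i ^ 2)).mul_const
      ((2 * Real.pi * α ^ 2) ^ ((n : ℝ) / 2))).mul_const
      (Real.exp ((∑ i, x i ^ 2) / (2 * α ^ 2)))
    have e : Real.exp (-((∑ i, x i ^ 2) / (2 * α ^ 2))) * (2 * Real.pi * α ^ 2) ^ ((n : ℝ) / 2) *
        Real.exp ((∑ i, x i ^ 2) / (2 * α ^ 2)) = (2 * Real.pi * α ^ 2) ^ ((n : ℝ) / 2) := by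
      rw [mul_right_comm, ← Real.exp_add]
      simp
    rw [e] at h
    refine h.congr' ?_
    filter_upwards [(aux_atop α hα a hlim).eventually_gt_atTop (∑ i, x i ^ 2)] with N hN
    unfold omegaWeight
    rw [if_pos hN]
  have h2 := ((Real.continuous_sqrt.tendsto _).comp h1).const_mul
    ((2 * Real.pi * α ^ 2) ^ (-(n : ℝ) / 4))
  have e : (2 * Real.pi * α ^ 2) ^ (-(n : ℝ) / 4) *
      Real.sqrt ((2 * Real.pi * α ^ 2) ^ ((n : ℝ) / 2)) = 1 := by
    have h3 : 0 ≤ (2 * Real.pi * α ^ 2) ^ (-(n : ℝ) / 4) *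
      Real.sqrt ((2 * Real.pi * α ^ 2) ^ ((n : ℝ) / 2)) := by positivity
    have h4 := aux_const n _ ht
    rw [← sq_eq_sq₀ h3 zero_le_one, mul_pow, Real.sq_sqrt (by positivity), h4, one_pow]
  rw [e] at h2
  exact h2

/-- `Δ^j x^K`. -/
noncomputable def lapK (n : ℕ) (K : Fin n → ℕ) (j : ℕ) : MvPolynomial (Fin n) ℝ :=
  (lapOn (Finset.univ : Finset (Fin n)))^[j] (∏ i : Fin n, X i ^ K i)

lemma aux_eval_Q (n N : ℕ) (a : ℝ) (ha : a ^ 2 ≠ 0) (K : Fin n → ℕ) (x : Fin n → ℝ) :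
    MvPolynomial.eval x (Qpoly n N a K) = ∑ j ∈ Finset.range ((∑ i, K i) / 2 + 1),
      (cBig (N - n) j * (a ^ 2) ^ j) * (1 - (∑ i, x i ^ 2) / a ^ 2) ^ j *
        MvPolynomial.eval x (lapK n K j) := by
  unfold Qpoly
  rw [map_sum]
  refine Finset.sum_congr rfl fun j _ => ?_
  simp only [map_mul, map_pow, map_sub, map_sum, MvPolynomial.eval_C, MvPolynomial.eval_X, lapK]
  have : a ^ 2 - ∑ i, x i ^ 2 = a ^ 2 * (1 - (∑ i, x i ^ 2) / a ^ 2) := by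
    rw [mul_sub, mul_one, mul_div_cancel₀ _ ha]
  rw [this, mul_pow]
  ring

lemma aux_eval_Qlim (n : ℕ) (α : ℝ) (K : Fin n → ℕ) (x : Fin n → ℝ) :
    MvPolynomial.eval x (Qlim n α K) = ∑ j ∈ Finset.range ((∑ i, K i) / 2 + 1),
      ((-1 : ℝ) ^ j * α ^ (2 * j) / (2 ^ j * (Nat.factorial j))) *
        MvPolynomial.eval x (lapK n K j) := by
  unfold Qlim
  rw [map_sum]
  refine Finset.sum_congr rfl fun j _ => ?_
  simp only [map_mul, MvPolynomial.eval_C, lapK]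

lemma aux_Q_lim (n : ℕ) (α : ℝ) (hα : 0 < α) (a : ℕ → ℝ) (K : Fin n → ℕ)
    (hlim : Tendsto (fun N : ℕ => a N / Real.sqrt ((N : ℝ) - 1)) atTop (nhds α))
    (x : Fin n → ℝ) :
    Tendsto (fun N : ℕ => MvPolynomial.eval x (Qpoly n N (a N) K)) atTop
      (nhds (MvPolynomial.eval x (Qlim n α K))) := by
  rw [aux_eval_Qlim]
  have hu : Tendsto (fun N : ℕ => 1 - (∑ i, x i ^ 2) / a N ^ 2) atTop (nhds 1) := by
    have := (tendsto_const_nhds (x := ∑ i, x i ^ 2)).div_atTop (aux_atop α hα a hlim)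
    simpa using this.const_sub 1
  have h : Tendsto (fun N : ℕ => ∑ j ∈ Finset.range ((∑ i, K i) / 2 + 1),
      (cBig (N - n) j * (a N ^ 2) ^ j) * (1 - (∑ i, x i ^ 2) / a N ^ 2) ^ j *
        MvPolynomial.eval x (lapK n K j)) atTop
      (nhds (∑ j ∈ Finset.range ((∑ i, K i) / 2 + 1),
      ((-1 : ℝ) ^ j * α ^ (2 * j) / (2 ^ j * (Nat.factorial j))) *
        MvPolynomial.eval x (lapK n K j))) := by
    refine tendsto_finsetSum _ fun j _ => ?_
    have := ((aux_cbig n α a hlim j).mul (hu.pow j)).mul_const (MvPolynomial.eval x (lapK n K j))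
    simpa using this
  refine h.congr' ?_
  filter_upwards [(aux_atop α hα a hlim).eventually_gt_atTop 0] with N hN
  rw [aux_eval_Q n N (a N) hN.ne']

/-- Dominating polynomial. -/
noncomputable def domPoly (n : ℕ) (α : ℝ) (K : Fin n → ℕ) : MvPolynomial (Fin n) ℝ :=
  C (((∑ i, K i) / 2 + 1 : ℕ) : ℝ) * ∑ j ∈ Finset.range ((∑ i, K i) / 2 + 1),
    C (((-1 : ℝ) ^ j * α ^ (2 * j) / (2 ^ j * (Nat.factorial j))) ^ 2 + 1) * lapK n K j ^ 2

lemma aux_dom (n : ℕ) (α : ℝ) (K : Fin n → ℕ) (x : Fin n → ℝ) (d : ℕ → ℝ)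
    (hd : ∀ j ∈ Finset.range ((∑ i, K i) / 2 + 1), d j ^ 2 ≤
      ((-1 : ℝ) ^ j * α ^ (2 * j) / (2 ^ j * (Nat.factorial j))) ^ 2 + 1) :
    (∑ j ∈ Finset.range ((∑ i, K i) / 2 + 1), d j * MvPolynomial.eval x (lapK n K j)) ^ 2
      ≤ MvPolynomial.eval x (domPoly n α K) := by
  refine le_trans sq_sum_le_card_mul_sum_sq ?_
  unfold domPoly
  simp only [map_mul, map_sum, MvPolynomial.eval_C, map_pow, Finset.card_range]
  refine mul_le_mul_of_nonneg_left (Finset.sum_le_sum fun j hj => ?_) (Nat.cast_nonneg _)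
  rw [mul_pow]
  exact mul_le_mul_of_nonneg_right (hd j hj) (sq_nonneg _)

lemma aux_meas_omega (n N : ℕ) (a α : ℝ) : Measurable (omegaWeight n N a α) := by
  unfold omegaWeight
  refine Measurable.ite ?_ ?_ measurable_const
  · exact measurableSet_lt (by fun_prop) measurable_const
  · fun_prop

lemma aux_meas_eval (n : ℕ) (p : MvPolynomial (Fin n) ℝ) :
    Measurable (fun x : Fin n → ℝ => MvPolynomial.eval x p) :=
  (MvPolynomial.continuous_eval p).measurable

theorem Qpoly_weighted_tendsto_L2_gaussian
    (n : ℕ) (hn : 1 ≤ n) (α : ℝ) (hα : 0 < α) (K : Fin n → ℕ) (a : ℕ → ℝ)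
    (ha : ∀ N, n < N → 0 < a N)
    (hlim : Tendsto (fun N : ℕ => a N / Real.sqrt ((N : ℝ) - 1)) atTop (nhds α)) :
    Tendsto (fun N : ℕ =>
        ∫ x, ((2 * Real.pi * α ^ 2) ^ (-(n : ℝ) / 4) * MvPolynomial.eval x (Qpoly n N (a N) K) *
              Real.sqrt (omegaWeight n N (a N) α x)
            - MvPolynomial.eval x (Qlim n α K)) ^ 2 ∂(gaussMeasure n α))
      atTop (nhds 0) := by
  have ht : 0 < 2 * Real.pi * α ^ 2 := by positivity
  have hconst := aux_const n _ ht
  set c : ℝ := (2 * Real.pi * α ^ 2) ^ (-(n : ℝ) / 2) with hc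
  have hc0 : 0 ≤ c := by positivity
  set k : ℝ := (2 * Real.pi * α ^ 2) ^ (-(n : ℝ) / 4) with hk
  set b : ℝ := 1 / (4 * α ^ 2) with hb
  have hb0 : 0 < b := by positivity
  have key : ∀ g : (Fin n → ℝ) → ℝ, ∫ x, g x ∂(gaussMeasure n α) =
      ∫ x, (c * Real.exp (-(∑ i, x i ^ 2) / (2 * α ^ 2))) * g x := by
    intro g
    unfold gaussMeasure
    rw [integral_withDensity_eq_integral_toReal_smul (by fun_prop)
      (Eventually.of_forall fun x => ENNReal.ofReal_lt_top)]
    refine integral_congr_ae (Eventually.of_forall fun x => ?_)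
    simp only [smul_eq_mul]
    rw [ENNReal.toReal_ofReal (by positivity)]
  simp_rw [key]
  have hz : (0 : ℝ) = ∫ _ : Fin n → ℝ, (0 : ℝ) := by simp
  rw [hz]
  refine tendsto_integral_filter_of_dominated_convergence
    (fun x => (4 * c) * (MvPolynomial.eval x (domPoly n α K) * Real.exp (-b * ∑ i, x i ^ 2)))
    ?_ ?_ ((aux_int n b hb0 _).const_mul _) ?_
  · refine Eventually.of_forall fun N => Measurable.aestronglyMeasurable ?_
    have h1 := aux_meas_omega n N (a N) α
    have h2 := aux_meas_eval n (Qpoly n N (a N) K)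
    have h3 := aux_meas_eval n (Qlim n α K)
    fun_prop
  · have hd : ∀ᶠ N : ℕ in atTop, ∀ j ∈ Finset.range ((∑ i, K i) / 2 + 1),
        (cBig (N - n) j * (a N ^ 2) ^ j) ^ 2 ≤
        ((-1 : ℝ) ^ j * α ^ (2 * j) / (2 ^ j * (Nat.factorial j))) ^ 2 + 1 := by
      rw [Filter.eventually_all_finset]
      intro j _
      exact (((aux_cbig n α a hlim j).pow 2).eventually_lt_const (lt_add_one _)).mono
        fun N h => h.le
    have hpb : ∀ᶠ N : ℕ in atTop, b < (((N : ℝ) - n - 1) / 2) / a N ^ 2 := by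
      refine (aux_p n α hα a hlim).eventually_const_lt ?_
      rw [hb]
      apply one_div_lt_one_div_of_lt <;> nlinarith [sq_pos_of_pos hα]
    filter_upwards [hd, hpb, (aux_atop α hα a hlim).eventually_gt_atTop 0,
      eventually_ge_atTop (n + 1)] with N hd hpb hA hN
    refine Eventually.of_forall fun x => ?_
    have hN' : ((n : ℝ) + 1) ≤ N := by exact_mod_cast hN
    set r : ℝ := ∑ i, x i ^ 2 with hr
    have hr0 : 0 ≤ r := Finset.sum_nonneg fun i _ => sq_nonneg _
    set Q := MvPolynomial.eval x (Qpoly n N (a N) K) with hQ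
    set L := MvPolynomial.eval x (Qlim n α K) with hL
    set D := MvPolynomial.eval x (domPoly n α K) with hD
    set w := omegaWeight n N (a N) α x with hw
    have hw0 : 0 ≤ w := aux_omega_nonneg _ _ _ _ _
    have hLD : L ^ 2 ≤ D := by
      rw [hL, aux_eval_Qlim]
      exact aux_dom n α K x _ fun j _ => by linarith
    have hD0 : 0 ≤ D := (sq_nonneg L).trans hLD
    have hexp : Real.exp (-r / (2 * α ^ 2)) ≤ Real.exp (-b * r) := by
      rw [Real.exp_le_exp, hb]
      have e : -(1 / (4 * α ^ 2)) * r = -r / (2 * α ^ 2) + r / (4 * α ^ 2) := by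
        field_simp
        ring
      have : 0 ≤ r / (4 * α ^ 2) := by positivity
      linarith
    have h1 : Real.exp (-r / (2 * α ^ 2)) * (k ^ 2 * w * Q ^ 2) ≤ Real.exp (-b * r) * D := by
      by_cases hra : r < a N ^ 2
      · have hu0 : 0 ≤ 1 - r / a N ^ 2 := by
          rw [sub_nonneg, div_le_one hA]
          exact hra.le
        have hu1 : 1 - r / a N ^ 2 ≤ 1 := by
          have : 0 ≤ r / a N ^ 2 := by positivity
          linarith
        have hQD : Q ^ 2 ≤ D := by
          rw [hQ, aux_eval_Q n N (a N) hA.ne']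
          refine aux_dom n α K x _ fun j hj => ?_
          refine le_trans ?_ (hd j hj)
          rw [mul_pow]
          refine mul_le_of_le_one_right (sq_nonneg _) ?_
          exact pow_le_one₀ (pow_nonneg hu0 _) (pow_le_one₀ hu0 hu1)
        have hww : Real.exp (-r / (2 * α ^ 2)) * (k ^ 2 * w) =
            (1 - r / a N ^ 2) ^ (((N : ℝ) - n - 1) / 2) := by
          rw [hw]
          unfold omegaWeight
          rw [if_pos hra]
          have he : Real.exp (-r / (2 * α ^ 2)) * Real.exp (r / (2 * α ^ 2)) = 1 := by
            rw [← Real.exp_add, neg_div, neg_add_cancel, Real.exp_zero]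
          calc _ = (1 - r / a N ^ 2) ^ (((N : ℝ) - n - 1) / 2) *
                (Real.exp (-r / (2 * α ^ 2)) * Real.exp (r / (2 * α ^ 2))) *
                (k ^ 2 * (2 * Real.pi * α ^ 2) ^ ((n : ℝ) / 2)) := by ring
            _ = _ := by rw [he, hconst, mul_one, mul_one]
        rw [← mul_assoc, hww]
        refine mul_le_mul ?_ hQD (sq_nonneg _) (Real.exp_pos _).le
        exact aux_weight_le _ _ _ _ hA (by linarith) hpb.le hr0 hra
      · have : w = 0 := by
          rw [hw]
          unfold omegaWeight
          rw [if_neg hra]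
        rw [this]
        simp only [mul_zero, zero_mul]
        positivity
    have h2 : Real.exp (-r / (2 * α ^ 2)) * L ^ 2 ≤ Real.exp (-b * r) * D :=
      mul_le_mul hexp hLD (sq_nonneg _) (Real.exp_pos _).le
    have h3 : (k * Q * Real.sqrt w - L) ^ 2 ≤ 2 * (k ^ 2 * w * Q ^ 2) + 2 * L ^ 2 := by
      have e : k ^ 2 * w * Q ^ 2 = (k * Q * Real.sqrt w) ^ 2 := by
        rw [mul_pow, mul_pow, Real.sq_sqrt hw0]
        ring
      rw [e]
      nlinarith [sq_nonneg (k * Q * Real.sqrt w + L)]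
    rw [Real.norm_of_nonneg (by positivity)]
    have h4 := mul_le_mul_of_nonneg_left h3 (Real.exp_pos (-r / (2 * α ^ 2))).le
    have h5 : Real.exp (-r / (2 * α ^ 2)) * (k * Q * Real.sqrt w - L) ^ 2 ≤
        4 * (Real.exp (-b * r) * D) := by nlinarith
    have h6 := mul_le_mul_of_nonneg_left h5 hc0
    calc _ = c * (Real.exp (-r / (2 * α ^ 2)) * (k * Q * Real.sqrt w - L) ^ 2) := by ring
      _ ≤ _ := h6
      _ = _ := by ring
  · refine Eventually.of_forall fun x => ?_
    have h := (((aux_pref_lim n α hα a hlim x).mul (aux_Q_lim n α hα a K hlim x)).sub_const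
      (MvPolynomial.eval x (Qlim n α K))).pow 2
    have h' := h.const_mul (c * Real.exp (-(∑ i, x i ^ 2) / (2 * α ^ 2)))
    rw [one_mul, sub_self, zero_pow two_ne_zero, mul_zero] at h'
    refine h'.congr fun N => ?_
    ring
end

section
/- Fix N ∈ ℕ with N > 2, a > 0 and α > 0 with a² − α²(N−2) > 0, and set A := (a² − α²(N−2))/a and r₀ := √(aA) ∈ (0,a). Then sup_{r ∈ (−a,a)} w_{N,a}(r)/w_∞(r) = w_{N,a}(r₀)/w_∞(r₀), and ((N−2)/(4a²)) A² < log( w_{N,a}(r₀)/w_∞(r₀) ) − log( w_{N,a}(0)/w_∞(0) ) < A²/(2α²). -/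
open Filter MeasureTheory

/-- `s_{N,a}(r) = 1 − r²/a²` (independent of `N`). -/
noncomputable def sFun (a r : ℝ) : ℝ := 1 - r ^ 2 / a ^ 2

/-- The normalized weight `w_{N,a}(r) = s_{N,a}(r)^{N/2−1} / ∫_{−a}^{a} s_{N,a}(ρ)^{N/2−1} dρ`
for `r ∈ (−a,a)`, and `0` for `|r| ≥ a`. -/
noncomputable def wFun (N : ℕ) (a r : ℝ) : ℝ :=
  if |r| < a then
    sFun a r ^ ((N : ℝ) / 2 - 1) / ∫ ρ in Set.Ioo (-a) a, sFun a ρ ^ ((N : ℝ) / 2 - 1)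
  else 0

/-- The Gaussian weight `w_∞(r) = (2π)^{−1/2} α^{−1} e^{−r²/(2α²)}`. -/
noncomputable def wInf (α r : ℝ) : ℝ :=
  (Real.sqrt (2 * Real.pi) * α)⁻¹ * Real.exp (-r ^ 2 / (2 * α ^ 2))

theorem aux_log_lower {t : ℝ} (h0 : 0 < t) (h1 : t < 1) :
    (1 - t) ^ 2 / 2 < Real.log t + 1 / t - 1 := by
  have hd : ∀ x : ℝ, 0 < x → HasDerivAt
      (fun x : ℝ => Real.log x + x⁻¹ - (1 - x) ^ 2 / 2)
      (x⁻¹ + -(x ^ 2)⁻¹ - (2 * (1 - x) * (-1)) / 2) x := by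
    intro x hx
    have h2 : HasDerivAt (fun x : ℝ => (1 - x) ^ 2) (2 * (1 - x) * (-1)) x := by
      simpa using ((hasDerivAt_id x).const_sub 1).fun_pow 2
    exact ((Real.hasDerivAt_log hx.ne').add (hasDerivAt_inv hx.ne')).sub (h2.div_const 2)
  have hanti : StrictAntiOn (fun x : ℝ => Real.log x + x⁻¹ - (1 - x) ^ 2 / 2) (Set.Icc t 1) := by
    apply strictAntiOn_of_deriv_neg (convex_Icc t 1)
    · intro x hx
      exact (hd x (lt_of_lt_of_le h0 hx.1)).continuousAt.continuousWithinAt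
    · intro x hx
      rw [interior_Icc] at hx
      have hx0 : 0 < x := h0.trans hx.1
      rw [(hd x hx0).deriv]
      have e : x⁻¹ + -(x ^ 2)⁻¹ - (2 * (1 - x) * (-1)) / 2
          = -((1 - x) ^ 2 * (1 + x) / x ^ 2) := by
        field_simp
        ring
      rw [e]
      have : 0 < 1 - x := by linarith [hx.2]
      have : 0 < (1 - x) ^ 2 * (1 + x) / x ^ 2 := by positivity
      linarith
  have h := hanti (Set.left_mem_Icc.2 h1.le) (Set.right_mem_Icc.2 h1.le) h1
  simp only [Real.log_one, inv_one] at h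
  rw [one_div]
  linarith

theorem aux_sFun_pos {a r : ℝ} (ha : 0 < a) (hr : |r| < a) : 0 < sFun a r := by
  unfold sFun
  have : r ^ 2 < a ^ 2 := sq_lt_sq' (abs_lt.1 hr).1 (abs_lt.1 hr).2
  rw [sub_pos, div_lt_one (by positivity)]
  exact this

theorem aux_integral_pos {a p : ℝ} (ha : 0 < a) (hp : 0 ≤ p) :
    0 < ∫ ρ in Set.Ioo (-a) a, sFun a ρ ^ p := by
  rw [← integral_Ioc_eq_integral_Ioo, ← intervalIntegral.integral_of_le (by linarith)]
  apply intervalIntegral.intervalIntegral_pos_of_pos_on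
  · apply Continuous.intervalIntegrable
    apply Continuous.rpow_const
    · unfold sFun
      fun_prop
    · intro x
      exact Or.inr hp
  · intro x hx
    exact Real.rpow_pos_of_pos (aux_sFun_pos ha (abs_lt.2 hx)) _
  · linarith

theorem aux_ratio (N : ℕ) (hN : 2 < N) (a α : ℝ) (ha : 0 < a) (hα : 0 < α) :
    ∃ K : ℝ, ∀ r : ℝ, |r| < a → wFun N a r / wInf α r
      = Real.exp (K + (((N : ℝ) - 2) / 2 * Real.log (sFun a r) + r ^ 2 / (2 * α ^ 2))) := by
  have hN' : (2 : ℝ) < N := by exact_mod_cast hN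
  have hI := aux_integral_pos (p := (N : ℝ) / 2 - 1) ha (by linarith)
  have hs : 0 < Real.sqrt (2 * Real.pi) := Real.sqrt_pos.2 (by positivity)
  refine ⟨Real.log (Real.sqrt (2 * Real.pi) * α / ∫ ρ in Set.Ioo (-a) a,
    sFun a ρ ^ ((N : ℝ) / 2 - 1)), fun r hr => ?_⟩
  rw [wFun, if_pos hr, wInf, Real.exp_add, Real.exp_log (by positivity), Real.exp_add,
    Real.rpow_def_of_pos (aux_sFun_pos ha hr), neg_div, Real.exp_neg,
    show ((N : ℝ) - 2) / 2 * Real.log (sFun a r) = Real.log (sFun a r) * ((N : ℝ) / 2 - 1) by ring]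
  have := Real.exp_pos (r ^ 2 / (2 * α ^ 2))
  generalize (∫ ρ in Set.Ioo (-a) a, sFun a ρ ^ ((N : ℝ) / 2 - 1)) = I at hI ⊢
  generalize Real.exp (r ^ 2 / (2 * α ^ 2)) = E at this ⊢
  field_simp

/-- for `N > 2` and `a² − α²(N−2) > 0`, setting `A = (a² − α²(N−2))/a` and
`r₀ = √(aA)`, one has `r₀ ∈ (0,a)`, the ratio `w_{N,a}/w_∞` attains its supremum over `(−a,a)`
at `r₀`, and `((N−2)/(4a²)) A² < log(w_{N,a}(r₀)/w_∞(r₀)) − log(w_{N,a}(0)/w_∞(0)) < A²/(2α²)`. -/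
theorem weight_ratio_max_and_log_bounds
    (N : ℕ) (hN : 2 < N) (a α : ℝ) (ha : 0 < a) (hα : 0 < α)
    (hpos : 0 < a ^ 2 - α ^ 2 * ((N : ℝ) - 2)) (A r₀ : ℝ)
    (hA : A = (a ^ 2 - α ^ 2 * ((N : ℝ) - 2)) / a) (hr₀ : r₀ = Real.sqrt (a * A)) :
    r₀ ∈ Set.Ioo 0 a ∧
    IsGreatest ((fun r => wFun N a r / wInf α r) '' Set.Ioo (-a) a) (wFun N a r₀ / wInf α r₀) ∧
    ((N : ℝ) - 2) / (4 * a ^ 2) * A ^ 2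
      < Real.log (wFun N a r₀ / wInf α r₀) - Real.log (wFun N a 0 / wInf α 0) ∧
    Real.log (wFun N a r₀ / wInf α r₀) - Real.log (wFun N a 0 / wInf α 0)
      < A ^ 2 / (2 * α ^ 2) := by
  have hN' : (2 : ℝ) < N := by exact_mod_cast hN
  obtain ⟨k, hk⟩ : ∃ k : ℝ, k = (N : ℝ) - 2 := ⟨_, rfl⟩
  have hk0 : 0 < k := by linarith
  obtain ⟨K, hK⟩ := aux_ratio N hN a α ha hα
  rw [← hk] at hpos hA hK ⊢
  obtain ⟨t, ht⟩ : ∃ t : ℝ, t = α ^ 2 * k / a ^ 2 := ⟨_, rfl⟩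
  have ht0 : 0 < t := by rw [ht]; positivity
  have ht1 : t < 1 := by rw [ht, div_lt_one (by positivity)]; linarith
  have hak : α ^ 2 * k = t * a ^ 2 := by rw [ht]; field_simp
  have hA' : A = a * (1 - t) := by
    rw [hA, hak]; field_simp
  have hα2 : α ^ 2 = t * a ^ 2 / k := by rw [← hak]; field_simp
  have h1t : 0 < 1 - t := by linarith
  have haA : 0 < a * A := by rw [hA']; positivity
  have hr2 : r₀ ^ 2 = a ^ 2 * (1 - t) := by
    rw [hr₀, Real.sq_sqrt haA.le, hA']; ring
  have hr0 : 0 < r₀ := by rw [hr₀]; exact Real.sqrt_pos.2 haA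
  have hra : r₀ < a := by
    apply lt_of_pow_lt_pow_left₀ 2 ha.le
    rw [hr2]
    have : 0 < a ^ 2 * t := by positivity
    linarith
  have habs : |r₀| < a := by rwa [abs_of_pos hr0]
  have hs0 : sFun a r₀ = t := by
    rw [sFun, hr2]; field_simp; ring
  have hz : sFun a 0 = 1 := by simp [sFun]
  -- rewriting of the quadratic part
  have hq : ∀ r : ℝ, r ^ 2 / (2 * α ^ 2) = k / 2 * ((1 - sFun a r) / t) := by
    intro r
    rw [sFun, hα2]; field_simp; ring
  have hdiff : Real.log (wFun N a r₀ / wInf α r₀) - Real.log (wFun N a 0 / wInf α 0)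
      = k / 2 * (Real.log t + 1 / t - 1) := by
    rw [hK r₀ habs, hK 0 (by simpa using ha), Real.log_exp, Real.log_exp, hq, hq, hs0, hz]
    simp only [Real.log_one]
    field_simp
    ring
  refine ⟨⟨hr0, hra⟩, ⟨⟨r₀, ⟨by linarith, hra⟩, rfl⟩, ?_⟩, ?_, ?_⟩
  · rintro _ ⟨r, hr, rfl⟩
    have hr' : |r| < a := abs_lt.2 hr
    have hsr := aux_sFun_pos ha hr'
    simp only []
    rw [hK r hr', hK r₀ habs, Real.exp_le_exp, hq, hq, hs0]
    have h := Real.log_le_sub_one_of_pos (div_pos hsr ht0)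
    rw [Real.log_div hsr.ne' ht0.ne'] at h
    have h2 : Real.log (sFun a r) + (1 - sFun a r) / t ≤ Real.log t + (1 - t) / t := by
      rw [sub_div, sub_div, div_self ht0.ne']
      linarith
    have := mul_le_mul_of_nonneg_left h2 (by positivity : 0 ≤ k / 2)
    linarith
  · rw [hdiff]
    have h := mul_lt_mul_of_pos_left (aux_log_lower ht0 ht1) (by positivity : 0 < k / 2)
    have e : k / (4 * a ^ 2) * A ^ 2 = k / 2 * ((1 - t) ^ 2 / 2) := by
      rw [hA']; field_simp; ring
    rw [e]; exact h
  · rw [hdiff]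
    have h := Real.log_lt_sub_one_of_pos ht0 ht1.ne
    have e : A ^ 2 / (2 * α ^ 2) = k / 2 * (t - 1 + 1 / t - 1) := by
      rw [hA', hα2]; field_simp; ring
    rw [e]
    apply mul_lt_mul_of_pos_left _ (by positivity : 0 < k / 2)
    linarith
end
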